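/- Let Γ̄, Δ̄ ∈ MCS_χ with Γ̄ R_○ Δ̄, where Γ, Δ ∈ MCS are the corresponding maximal CS-consistent sets. Then for every formula φ: (1) ○φ ∈ Γ iff φ ∈ Δ; (2) φ ∈ Γ iff Ⓢφ ∈ Δ; (3) φ ∈ Γ iff Ⓦφ ∈ Δ. -/

import Mathlib

namespace TJL

/-- Justification terms: constants, variables, !t, t+t, t·t. -/
inductive JTerm : Type
  | const : ℕ → JTerm
  | var : ℕ → JTerm
  | bang : JTerm → JTerm
  | plus : JTerm → JTerm → JTerm
  | app : JTerm → JTerm → JTerm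

/-- Formulas of LPLTL^P with `h` agents. -/
inductive Formula (h : ℕ) : Type
  | atom : ℕ → Formula h
  | bot : Formula h
  | imp : Formula h → Formula h → Formula h
  | next : Formula h → Formula h
  | wprev : Formula h → Formula h
  | funtil : Formula h → Formula h → Formula h
  | fsince : Formula h → Formula h → Formula h
  | jbox : JTerm → Fin h → Formula h → Formula h

namespace Formula

variable {h : ℕ}

def neg (φ : Formula h) : Formula h := φ.imp .bot
def top : Formula h := neg .bot
def sprev (φ : Formula h) : Formula h := neg (wprev (neg φ))
def ev (φ : Formula h) : Formula h := funtil top φ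
def always (φ : Formula h) : Formula h := neg (ev (neg φ))
def once (φ : Formula h) : Formula h := fsince top φ
def halways (φ : Formula h) : Formula h := neg (once (neg φ))
def or' (φ ψ : Formula h) : Formula h := (neg φ).imp ψ
def and' (φ ψ : Formula h) : Formula h := neg (or' (neg φ) (neg ψ))
def iff' (φ ψ : Formula h) : Formula h := and' (φ.imp ψ) (ψ.imp φ)

end Formula

open Formula

/-- A boolean valuation respecting ⊥ and →. -/
def IsPropEval {h : ℕ} (v : Formula h → Bool) : Prop :=
  v .bot = false ∧ ∀ φ ψ : Formula h, v (φ.imp ψ) = (!(v φ) || v ψ)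

/-- Propositional tautologies. -/
def Tautology {h : ℕ} (φ : Formula h) : Prop :=
  ∀ v : Formula h → Bool, IsPropEval v → v φ = true

/-- The axioms of LPLTL^P. -/
inductive Ax {h : ℕ} : Formula h → Prop
  | taut (φ : Formula h) : Tautology φ → Ax φ
  | nextK (φ ψ : Formula h) : Ax ((Formula.next (φ.imp ψ)).imp ((Formula.next φ).imp (Formula.next ψ)))
  | boxK (φ ψ : Formula h) : Ax ((always (φ.imp ψ)).imp ((always φ).imp (always ψ)))
  | func (φ : Formula h) : Ax (iff' (Formula.next (neg φ)) (neg (Formula.next φ)))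
  | ind (φ : Formula h) : Ax ((always (φ.imp (Formula.next φ))).imp (φ.imp (always φ)))
  | until1 (φ ψ : Formula h) : Ax ((Formula.funtil φ ψ).imp (ev ψ))
  | until2 (φ ψ : Formula h) :
      Ax (iff' (Formula.funtil φ ψ) (or' ψ (and' φ (Formula.next (Formula.funtil φ ψ)))))
  | hboxK (φ ψ : Formula h) : Ax ((halways (φ.imp ψ)).imp ((halways φ).imp (halways ψ)))
  | wprevK (φ ψ : Formula h) :
      Ax ((Formula.wprev (φ.imp ψ)).imp ((Formula.wprev φ).imp (Formula.wprev ψ)))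
  | sw (φ : Formula h) : Ax ((sprev φ).imp (Formula.wprev φ))
  | fp (φ : Formula h) : Ax (φ.imp (Formula.next (sprev φ)))
  | pf (φ : Formula h) : Ax (φ.imp (Formula.wprev (Formula.next φ)))
  | initial : Ax (once (Formula.wprev (.bot : Formula h)))
  | hind (φ : Formula h) : Ax ((halways (φ.imp (Formula.wprev φ))).imp (φ.imp (halways φ)))
  | since1 (φ ψ : Formula h) : Ax ((Formula.fsince φ ψ).imp (once ψ))
  | since2 (φ ψ : Formula h) :
      Ax (iff' (Formula.fsince φ ψ) (or' ψ (and' φ (sprev (Formula.fsince φ ψ)))))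
  | japp (t s : JTerm) (i : Fin h) (φ ψ : Formula h) :
      Ax ((Formula.jbox t i (φ.imp ψ)).imp ((Formula.jbox s i φ).imp (Formula.jbox (.app t s) i ψ)))
  | jsum1 (t s : JTerm) (i : Fin h) (φ : Formula h) :
      Ax ((Formula.jbox t i φ).imp (Formula.jbox (.plus t s) i φ))
  | jsum2 (t s : JTerm) (i : Fin h) (φ : Formula h) :
      Ax ((Formula.jbox s i φ).imp (Formula.jbox (.plus t s) i φ))
  | jrefl (t : JTerm) (i : Fin h) (φ : Formula h) : Ax ((Formula.jbox t i φ).imp φ)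
  | jpos (t : JTerm) (i : Fin h) (φ : Formula h) :
      Ax ((Formula.jbox t i φ).imp (Formula.jbox (.bang t) i (Formula.jbox t i φ)))

/-- Formulas of the shape [c_n]_{i_n}⋯[c_1]_{i_1}φ with n ≥ 1 and φ an axiom instance. -/
inductive CSForm {h : ℕ} : Formula h → Prop
  | base (c : ℕ) (i : Fin h) (φ : Formula h) : Ax φ → CSForm (.jbox (.const c) i φ)
  | step (c : ℕ) (i : Fin h) (φ : Formula h) : CSForm φ → CSForm (.jbox (.const c) i φ)

/-- Downward-closed constant specifications. -/
def IsConstSpec {h : ℕ} (CS : Set (Formula h)) : Prop :=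
  (∀ φ ∈ CS, CSForm φ) ∧
  (∀ (c : ℕ) (i : Fin h) (φ : Formula h),
    Formula.jbox (.const c) i φ ∈ CS → CSForm φ → φ ∈ CS)

/-- Derivability in LPLTL^P_CS. -/
inductive Deriv {h : ℕ} (CS : Set (Formula h)) : Formula h → Prop
  | ax {φ : Formula h} : Ax φ → Deriv CS φ
  | cs {φ : Formula h} : φ ∈ CS → Deriv CS φ
  | mp {φ ψ : Formula h} : Deriv CS (φ.imp ψ) → Deriv CS φ → Deriv CS ψ
  | necNext {φ : Formula h} : Deriv CS φ → Deriv CS (.next φ)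
  | necWprev {φ : Formula h} : Deriv CS φ → Deriv CS (.wprev φ)
  | necBox {φ : Formula h} : Deriv CS φ → Deriv CS (always φ)
  | necHbox {φ : Formula h} : Deriv CS φ → Deriv CS (halways φ)

def conjList {h : ℕ} : List (Formula h) → Formula h
  | [] => top
  | φ :: l => and' φ (conjList l)

def disjList {h : ℕ} : List (Formula h) → Formula h
  | [] => .bot
  | φ :: l => or' φ (disjList l)

/-- Γ ⊢_CS φ : derivability from assumptions. -/
def DerivFrom {h : ℕ} (CS : Set (Formula h)) (Γ : Set (Formula h)) (φ : Formula h) : Prop :=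
  ∃ L : List (Formula h), (∀ ψ ∈ L, ψ ∈ Γ) ∧ Deriv CS ((conjList L).imp φ)

/-- CS-consistency. -/
def Consistent {h : ℕ} (CS : Set (Formula h)) (Γ : Set (Formula h)) : Prop :=
  ¬ DerivFrom CS Γ .bot

/-- Maximal CS-consistent sets. -/
def MaxCons {h : ℕ} (CS : Set (Formula h)) (Γ : Set (Formula h)) : Prop :=
  Consistent CS Γ ∧ ∀ Δ, Γ ⊆ Δ → Consistent CS Δ → Δ = Γ

/-- Subformulas. -/
def Subf {h : ℕ} : Formula h → Set (Formula h)
  | .atom P => {.atom P}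
  | .bot => {.bot}
  | .imp φ ψ => insert (.imp φ ψ) (Subf φ ∪ Subf ψ)
  | .next φ => insert (.next φ) (Subf φ)
  | .wprev φ => insert (.wprev φ) (Subf φ)
  | .funtil φ ψ => insert (.funtil φ ψ) (Subf φ ∪ Subf ψ)
  | .fsince φ ψ => insert (.fsince φ ψ) (Subf φ ∪ Subf ψ)
  | .jbox t i φ => insert (.jbox t i φ) (Subf φ)

/-- A_χ := Sub(χ) ∪ Sub(⊤ S Ⓦ⊥). -/
def Achi {h : ℕ} (χ : Formula h) : Set (Formula h) :=
  Subf χ ∪ Subf (Formula.fsince top (Formula.wprev .bot))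

/-- Sub⁺(χ) := A_χ ∪ {¬ψ | ψ ∈ A_χ}. -/
def SubPlus {h : ℕ} (χ : Formula h) : Set (Formula h) :=
  Achi χ ∪ (neg '' Achi χ)

/-- MCS_χ : the χ-maximal CS-consistent subsets of Sub⁺(χ). -/
def ChiMCS {h : ℕ} (CS : Set (Formula h)) (χ : Formula h) : Set (Set (Formula h)) :=
  {Γb | Γb ⊆ SubPlus χ ∧ Consistent CS Γb ∧
    ∀ Δ, Γb ⊆ Δ → Δ ⊆ SubPlus χ → Consistent CS Δ → Δ = Γb}

/-- The relation R_○ on MCS_χ, via representatives Γ, Δ ∈ MCS: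
    Γ̄ R_○ Δ̄ iff {○φ | φ ∈ Δ} ⊆ Γ. -/
def RNext {h : ℕ} (CS : Set (Formula h)) (χ : Formula h) (Γb Δb : Set (Formula h)) : Prop :=
  ∃ Γ Δ : Set (Formula h), MaxCons CS Γ ∧ MaxCons CS Δ ∧
    Γb = Γ ∩ SubPlus χ ∧ Δb = Δ ∩ SubPlus χ ∧
    ∀ φ ∈ Δ, Formula.next φ ∈ Γ

/-- γ is a conjunction of all elements of the finite set S (in some order). -/
def IsConj {h : ℕ} (S : Set (Formula h)) (γ : Formula h) : Prop :=
  ∃ L : List (Formula h), L.Nodup ∧ (∀ ψ, ψ ∈ L ↔ ψ ∈ S) ∧ γ = conjList L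

/-- Acceptable sequences of elements of MCS_χ. -/
def Acceptable {h : ℕ} (CS : Set (Formula h)) (χ : Formula h)
    (f : ℕ → Set (Formula h)) : Prop :=
  (∀ n, f n ∈ ChiMCS CS χ) ∧
  (∀ n, RNext CS χ (f n) (f (n + 1))) ∧
  (∀ n (φ ψ : Formula h), Formula.funtil φ ψ ∈ f n →
    ∃ m, n ≤ m ∧ ψ ∈ f m ∧ ∀ k, n ≤ k → k < m → φ ∈ f k) ∧
  Formula.wprev .bot ∈ f 0

end TJL

namespace TJL

open Formula

variable {h : ℕ} {CS Γ : Set (Formula h)} {φ ψ : Formula h}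

theorem IsPropEval.neg {v : Formula h → Bool} (hv : IsPropEval v) (φ : Formula h) :
    v φ.neg = !(v φ) := by
  simp [Formula.neg, hv.1, hv.2]

theorem IsPropEval.and {v : Formula h → Bool} (hv : IsPropEval v) (φ ψ : Formula h) :
    v (and' φ ψ) = (v φ && v ψ) := by
  simp [and', or', hv.neg, hv.2]

theorem IsPropEval.conjList {v : Formula h → Bool} (hv : IsPropEval v) (L : List (Formula h)) :
    v (conjList L) = true ↔ ∀ ψ ∈ L, v ψ = true := by
  induction L with
  | nil => simp [TJL.conjList, top, hv.neg, hv.1]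
  | cons φ l ih => simp [TJL.conjList, hv.and, ih]

/-- Derivability is closed under propositional consequence from one premise. -/
theorem Deriv.of_taut (hd : Deriv CS φ)
    (ht : ∀ v, IsPropEval v → v φ = true → v ψ = true) : Deriv CS ψ := by
  refine .mp (.ax (.taut _ fun v hv => ?_)) hd
  have := ht v hv
  rw [hv.2]
  cases hφ : v φ <;> simp_all

/-- Derivability is closed under propositional consequence from two premises. -/
theorem Deriv.of_taut₂ {θ : Formula h} (hφ : Deriv CS φ) (hψ : Deriv CS ψ)
    (ht : ∀ v, IsPropEval v → v φ = true → v ψ = true → v θ = true) : Deriv CS θ := by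
  refine .mp (hφ.of_taut fun v hv h₁ => ?_) hψ
  have := ht v hv h₁
  rw [hv.2]
  cases h₂ : v ψ <;> simp_all

/-- The deduction theorem for refutations: if `φ` is inconsistent with `Γ`, then `Γ ⊢ ¬φ`. -/
theorem DerivFrom.neg_of_insert (hd : DerivFrom CS (insert φ Γ) .bot) :
    DerivFrom CS Γ φ.neg := by
  classical
  obtain ⟨L, hL, hd⟩ := hd
  refine ⟨L.filter (· ≠ φ), fun ψ hψ => ?_, hd.of_taut fun v hv hd => ?_⟩
  · obtain ⟨hψL, hne⟩ := List.mem_filter.1 hψ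
    exact (hL ψ hψL).resolve_left (by simpa using hne)
  · by_contra hc
    simp only [hv.2, hv.neg, Bool.or_eq_true, Bool.not_eq_true', not_or,
      Bool.not_eq_false] at hc
    obtain ⟨hf, hφ⟩ := hc
    have hall : v (conjList L) = true := (hv.conjList L).2 fun ψ hψ => by
      by_cases he : ψ = φ
      · rw [he, hφ]
      · exact (hv.conjList _).1 hf ψ (List.mem_filter.2 ⟨hψ, by simpa using he⟩)
    simp [hv.2, hall, hv.1] at hd

theorem Consistent.not_derivFrom_neg (hc : Consistent CS Γ) (hφ : DerivFrom CS Γ φ) :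
    ¬ DerivFrom CS Γ φ.neg := by
  rintro ⟨L₂, hL₂, hd₂⟩
  obtain ⟨L₁, hL₁, hd₁⟩ := hφ
  refine hc ⟨L₁ ++ L₂, fun ψ hψ => (List.mem_append.1 hψ).elim (hL₁ ψ) (hL₂ ψ),
    hd₁.of_taut₂ hd₂ fun v hv h₁ h₂ => ?_⟩
  by_contra hc
  simp only [hv.2, hv.1, Bool.or_false, Bool.not_eq_true', Bool.not_eq_false] at hc
  have hall := (hv.conjList _).1 hc
  have e₁ := (hv.conjList L₁).2 fun ψ hψ => hall ψ (List.mem_append_left _ hψ)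
  have e₂ := (hv.conjList L₂).2 fun ψ hψ => hall ψ (List.mem_append_right _ hψ)
  simp_all [hv.2, hv.neg]

theorem DerivFrom.of_mem (hφ : φ ∈ Γ) : DerivFrom CS Γ φ :=
  ⟨[φ], by simpa using hφ, .ax (.taut _ fun v hv => by
    have := hv.conjList [φ]
    cases h₁ : v φ <;> simp_all [hv.2])⟩

theorem MaxCons.derivFrom_neg_of_notMem (hΓ : MaxCons CS Γ) (hφ : φ ∉ Γ) :
    DerivFrom CS Γ φ.neg := by
  refine DerivFrom.neg_of_insert (not_not.1 fun hc => hφ ?_)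
  rw [← hΓ.2 (insert φ Γ) (Set.subset_insert _ _) hc]
  exact Set.mem_insert _ _

/-- Maximal consistent sets are deductively closed. -/
theorem MaxCons.mem_of_derivFrom (hΓ : MaxCons CS Γ) (hd : DerivFrom CS Γ φ) : φ ∈ Γ :=
  not_not.1 fun hφ => hΓ.1.not_derivFrom_neg hd (hΓ.derivFrom_neg_of_notMem hφ)

theorem MaxCons.neg_mem_iff (hΓ : MaxCons CS Γ) : φ.neg ∈ Γ ↔ φ ∉ Γ :=
  ⟨fun hn hφ => hΓ.1.not_derivFrom_neg (.of_mem hφ) (.of_mem hn),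
    fun hφ => hΓ.mem_of_derivFrom (hΓ.derivFrom_neg_of_notMem hφ)⟩

theorem MaxCons.mem_of_deriv_imp (hΓ : MaxCons CS Γ) (hd : Deriv CS (φ.imp ψ)) (hφ : φ ∈ Γ) :
    ψ ∈ Γ :=
  hΓ.mem_of_derivFrom ⟨[φ], by simpa using hφ, hd.of_taut fun v hv h₁ => by
    have := hv.conjList [φ]
    cases h₂ : v φ <;> simp_all [hv.2]⟩

theorem deriv_next_neg_imp (φ : Formula h) :
    Deriv CS ((Formula.next φ.neg).imp (Formula.next φ).neg) :=
  (Deriv.ax (.func φ)).of_taut fun v hv h₁ => by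
    rw [iff', hv.and, Bool.and_eq_true] at h₁
    exact h₁.1

theorem deriv_wprev_imp_wprev_neg_neg (φ : Formula h) :
    Deriv CS ((Formula.wprev φ).imp (Formula.wprev φ.neg.neg)) :=
  .mp (.ax (.wprevK _ _)) (.necWprev (.ax (.taut _ fun v hv => by
    simp [hv.2, hv.neg])))

end TJL

open TJL TJL.Formula in
/-- Properties of R_○: for Γ̄, Δ̄ ∈ MCS_χ with Γ̄ R_○ Δ̄ (Γ, Δ ∈ MCS the
    corresponding maximal CS-consistent sets), for every formula φ:
    ○φ ∈ Γ iff φ ∈ Δ; φ ∈ Γ iff Ⓢφ ∈ Δ; φ ∈ Γ iff Ⓦφ ∈ Δ. -/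
theorem rnext_properties (h : ℕ) (hh : 1 ≤ h)
    (CS : Set (Formula h)) (hCS : IsConstSpec CS) (χ : Formula h)
    (Γ Δ : Set (Formula h)) (hΓ : MaxCons CS Γ) (hΔ : MaxCons CS Δ)
    (hΓb : Γ ∩ SubPlus χ ∈ ChiMCS CS χ) (hΔb : Δ ∩ SubPlus χ ∈ ChiMCS CS χ)
    (hR : ∀ φ ∈ Δ, Formula.next φ ∈ Γ) :
    ∀ φ : Formula h,
      (Formula.next φ ∈ Γ ↔ φ ∈ Δ) ∧
      (φ ∈ Γ ↔ sprev φ ∈ Δ) ∧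
      (φ ∈ Γ ↔ Formula.wprev φ ∈ Δ) := by
  intro φ
  have next_iff : ∀ ψ, Formula.next ψ ∈ Γ ↔ ψ ∈ Δ := fun ψ =>
    ⟨fun hn => not_not.1 fun hψ => hΓ.neg_mem_iff.1
      (hΓ.mem_of_deriv_imp (deriv_next_neg_imp ψ) (hR _ (hΔ.neg_mem_iff.2 hψ))) hn, hR ψ⟩
  have sprev_mem : ∀ ψ ∈ Γ, sprev ψ ∈ Δ := fun ψ hψ =>
    (next_iff _).1 (hΓ.mem_of_deriv_imp (.ax (.fp ψ)) hψ)
  have wprev_mem : ∀ ψ ∈ Γ, Formula.wprev ψ ∈ Δ := fun ψ hψ =>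
    hΔ.mem_of_deriv_imp (.ax (.sw ψ)) (sprev_mem ψ hψ)
  refine ⟨next_iff φ, ⟨sprev_mem φ, fun hs => not_not.1 fun hφ => ?_⟩,
    ⟨wprev_mem φ, fun hw => not_not.1 fun hφ => ?_⟩⟩
  · exact hΔ.neg_mem_iff.1 hs (wprev_mem _ (hΓ.neg_mem_iff.2 hφ))
  · exact hΔ.neg_mem_iff.1 (sprev_mem _ (hΓ.neg_mem_iff.2 hφ))
      (hΔ.mem_of_deriv_imp (deriv_wprev_imp_wprev_neg_neg φ) hw)
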